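/- There is no smooth positive function u : ℝⁿ → ℝ (n ≥ 1) satisfying Δu + a·u^{p+1} = 0 on all of ℝⁿ, when a > 0 and p < 4/n. -/

import Mathlib

/-- The (i,j) second partial derivative of `f` at `x`. -/
noncomputable def secondDeriv (n : ℕ) (f : EuclideanSpace ℝ (Fin n) → ℝ)
    (x : EuclideanSpace ℝ (Fin n)) (i j : Fin n) : ℝ :=
  iteratedFDeriv ℝ 2 f x ![EuclideanSpace.single i 1, EuclideanSpace.single j 1]

/-- The Laplacian of `f` at `x`, as the trace of the Hessian. -/
noncomputable def lap (n : ℕ) (f : EuclideanSpace ℝ (Fin n) → ℝ)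
    (x : EuclideanSpace ℝ (Fin n)) : ℝ :=
  ∑ i, secondDeriv n f x i i

open scoped ContDiff

namespace Liou

/-- Partial derivative. -/
noncomputable def D {n : ℕ} (i : Fin n) (f : EuclideanSpace ℝ (Fin n) → ℝ) :
    EuclideanSpace ℝ (Fin n) → ℝ :=
  fun x => fderiv ℝ f x (EuclideanSpace.single i 1)

variable {n : ℕ}

lemma D_smooth (i : Fin n) {f : EuclideanSpace ℝ (Fin n) → ℝ} (hf : ContDiff ℝ ∞ f) :
    ContDiff ℝ ∞ (D i f) :=
  (hf.fderiv_right (m := ∞) (by simp)).clm_apply contDiff_const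

lemma diffAt {f : EuclideanSpace ℝ (Fin n) → ℝ} (hf : ContDiff ℝ ∞ f)
    (x : EuclideanSpace ℝ (Fin n)) : DifferentiableAt ℝ f x :=
  (hf.differentiable (by simp)) x

lemma D_mul (i : Fin n) {f g : EuclideanSpace ℝ (Fin n) → ℝ} (hf : ContDiff ℝ ∞ f)
    (hg : ContDiff ℝ ∞ g) :
    D i (fun x => f x * g x) = fun x => D i f x * g x + f x * D i g x := by
  funext x
  simp only [D]
  rw [fderiv_fun_mul (diffAt hf x) (diffAt hg x)]
  simp
  ring

lemma D_add (i : Fin n) {f g : EuclideanSpace ℝ (Fin n) → ℝ} (hf : ContDiff ℝ ∞ f)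
    (hg : ContDiff ℝ ∞ g) :
    D i (fun x => f x + g x) = fun x => D i f x + D i g x := by
  funext x
  simp only [D]
  rw [fderiv_fun_add (diffAt hf x) (diffAt hg x)]
  simp

lemma D_neg (i : Fin n) (f : EuclideanSpace ℝ (Fin n) → ℝ) :
    D i (fun x => - f x) = fun x => - D i f x := by
  funext x
  simp only [D]
  rw [fderiv_fun_neg]
  simp

lemma D_sum (i : Fin n) {f : Fin n → EuclideanSpace ℝ (Fin n) → ℝ}
    (hf : ∀ j, ContDiff ℝ ∞ (f j)) :
    D i (fun x => ∑ j, f j x) = fun x => ∑ j, D i (f j) x := by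
  funext x
  simp only [D]
  rw [fderiv_fun_sum (fun j _ => diffAt (hf j) x)]
  simp

lemma D_const (i : Fin n) (c : ℝ) : D i (fun _ : EuclideanSpace ℝ (Fin n) => c) = fun _ => 0 := by
  funext x
  simp [D]

lemma D_coord (i j : Fin n) :
    D i (fun x : EuclideanSpace ℝ (Fin n) => x j) = fun _ => if i = j then 1 else 0 := by
  funext x
  have h : (fun x : EuclideanSpace ℝ (Fin n) => x j) = EuclideanSpace.proj (𝕜 := ℝ) j := by
    funext x; simp
  simp only [D, h, ContinuousLinearMap.fderiv]
  simp [Pi.single_apply, eq_comm]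

lemma D_D (i j : Fin n) {f : EuclideanSpace ℝ (Fin n) → ℝ} (hf : ContDiff ℝ ∞ f)
    (x : EuclideanSpace ℝ (Fin n)) :
    D i (D j f) x = fderiv ℝ (fderiv ℝ f) x (EuclideanSpace.single i 1)
      (EuclideanSpace.single j 1) := by
  have h : DifferentiableAt ℝ (fderiv ℝ f) x :=
    (hf.fderiv_right (m := ∞) (by simp)).differentiable (by simp) x
  unfold D
  rw [fderiv_clm_apply h (by fun_prop)]
  simp

lemma D_comm (i j : Fin n) {f : EuclideanSpace ℝ (Fin n) → ℝ} (hf : ContDiff ℝ ∞ f) :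
    D i (D j f) = D j (D i f) := by
  funext x
  rw [D_D i j hf, D_D j i hf]
  have := (hf.contDiffAt (x := x)).isSymmSndFDerivAt (by simpa using (WithTop.coe_le_coe.2 (le_top : (2 : ℕ∞) ≤ ⊤)))
  exact this _ _

lemma lap_eq {f : EuclideanSpace ℝ (Fin n) → ℝ} (hf : ContDiff ℝ ∞ f)
    (x : EuclideanSpace ℝ (Fin n)) : lap n f x = ∑ i, D i (D i f) x := by
  unfold lap secondDeriv
  refine Finset.sum_congr rfl fun i _ => ?_
  rw [D_D i i hf, iteratedFDeriv_two_apply]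
  simp

lemma D_line (i : Fin n) {f : EuclideanSpace ℝ (Fin n) → ℝ} (hf : ContDiff ℝ ∞ f)
    (x : EuclideanSpace ℝ (Fin n)) (t : ℝ) :
    HasDerivAt (fun t : ℝ => f (x + t • EuclideanSpace.single i (1 : ℝ)))
      (D i f (x + t • EuclideanSpace.single i (1 : ℝ))) t := by
  have h1 : HasDerivAt (fun t : ℝ => x + t • EuclideanSpace.single i (1 : ℝ))
      (EuclideanSpace.single i (1 : ℝ)) t := by
    simpa using ((hasDerivAt_id t).smul_const (EuclideanSpace.single i (1 : ℝ))).const_add x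
  exact (diffAt hf _).hasFDerivAt.comp_hasDerivAt t h1

lemma D_max (i : Fin n) {f : EuclideanSpace ℝ (Fin n) → ℝ} 
    {x : EuclideanSpace ℝ (Fin n)} (hm : IsLocalMax f x) : D i f x = 0 := by
  simp [D, hm.fderiv_eq_zero]

lemma DD_max (i : Fin n) {f : EuclideanSpace ℝ (Fin n) → ℝ} (hf : ContDiff ℝ ∞ f)
    {x : EuclideanSpace ℝ (Fin n)} (hm : IsLocalMax f x) : D i (D i f) x ≤ 0 := by
  by_contra! hpos
  set φ : ℝ → ℝ := fun t : ℝ => f (x + t • EuclideanSpace.single i (1 : ℝ)) with hφ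
  have d1 : deriv φ = fun t => D i f (x + t • EuclideanSpace.single i (1 : ℝ)) := by
    funext t; exact (D_line i hf x t).deriv
  have d2 : deriv (deriv φ) = fun t => D i (D i f) (x + t • EuclideanSpace.single i (1 : ℝ)) := by
    rw [d1]; funext t; exact (D_line i (D_smooth i hf) x t).deriv
  have hmin : IsLocalMin φ 0 := by
    apply isLocalMin_of_deriv_deriv_pos
    · rw [d2]; simpa using hpos
    · rw [d1]; simpa using D_max i hm
    · exact (D_line i hf x 0).continuousAt
  have hmax : IsLocalMax φ 0 := by
    have hc : ContinuousAt (fun t : ℝ => x + t • EuclideanSpace.single i (1 : ℝ)) 0 := by fun_prop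
    have : Filter.Tendsto (fun t : ℝ => x + t • EuclideanSpace.single i (1 : ℝ)) (nhds 0) (nhds x) := by
      simpa [ContinuousAt] using hc
    have h := this.eventually hm
    filter_upwards [h] with t ht
    simpa [hφ] using ht
  have heq : φ =ᶠ[nhds 0] fun _ => φ 0 := by
    filter_upwards [hmin, hmax] with t h1 h2
    exact le_antisymm h2 h1
  have h2 := heq.deriv.deriv.eq_of_nhds
  rw [d2] at h2
  simp at h2
  linarith

/-- squared gradient -/
noncomputable def gr (w : EuclideanSpace ℝ (Fin n) → ℝ) : EuclideanSpace ℝ (Fin n) → ℝ :=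
  fun x => ∑ i, D i w x * D i w x

lemma gr_smooth {w : EuclideanSpace ℝ (Fin n) → ℝ} (hw : ContDiff ℝ ∞ w) :
    ContDiff ℝ ∞ (gr w) :=
  ContDiff.sum fun i _ => (D_smooth i hw).mul (D_smooth i hw)

lemma D_gr {w : EuclideanSpace ℝ (Fin n) → ℝ} (hw : ContDiff ℝ ∞ w) (j : Fin n) :
    D j (gr w) = fun x => ∑ i, (D j (D i w) x * D i w x + D i w x * D j (D i w) x) := by
  unfold gr
  rw [D_sum j (fun i => (D_smooth i hw).mul (D_smooth i hw))]
  funext x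
  refine Finset.sum_congr rfl fun i _ => ?_
  rw [D_mul j (D_smooth i hw) (D_smooth i hw)]

lemma DD_gr {w : EuclideanSpace ℝ (Fin n) → ℝ} (hw : ContDiff ℝ ∞ w) (j : Fin n)
    (x : EuclideanSpace ℝ (Fin n)) :
    D j (D j (gr w)) x = ∑ i, (2 * D j (D i w) x ^ 2 + 2 * (D i w x * D j (D j (D i w)) x)) := by
  have s1 := fun i => D_smooth i hw
  have s2 := fun i => D_smooth j (s1 i)
  rw [D_gr hw, D_sum j (fun i => ((s2 i).mul (s1 i)).add ((s1 i).mul (s2 i)))]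
  refine Finset.sum_congr rfl fun i _ => ?_
  rw [D_add j ((s2 i).mul (s1 i)) ((s1 i).mul (s2 i)), D_mul j (s2 i) (s1 i), D_mul j (s1 i) (s2 i)]
  ring

/-- Bochner. -/
lemma bochner {w h : EuclideanSpace ℝ (Fin n) → ℝ} (hw : ContDiff ℝ ∞ w) (hh : ContDiff ℝ ∞ h)
    {p : ℝ} (hD : ∀ i x, D i h x = p * h x * D i w x)
    (heq : ∀ x, ∑ i, D i (D i w) x = -(gr w x + h x)) (x : EuclideanSpace ℝ (Fin n)) :
    ∑ j, D j (D j (gr w)) x = 2 * ∑ j, ∑ i, D j (D i w) x ^ 2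
      - 2 * ∑ i, D i w x * D i (gr w) x - 2 * p * h x * gr w x := by
  have key : ∀ i, ∑ j, D j (D j (D i w)) x = - D i (gr w) x - p * h x * D i w x := by
    intro i
    have e1 : ∀ j, D j (D j (D i w)) = D i (D j (D j w)) := by
      intro j
      rw [D_comm j i hw, D_comm j i (D_smooth j hw)]
    have e2 : (fun x => ∑ j, D j (D j w) x) = fun x => -(gr w x + h x) := funext heq
    have e3 := congrArg (D i) e2
    rw [D_sum i (fun j => D_smooth j (D_smooth j hw)), D_neg, D_add i (gr_smooth hw) hh] at e3
    have e4 := congrFun e3 x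
    simp only [e1]
    simp only [hD] at e4
    rw [e4]; ring
  simp_rw [DD_gr hw, Finset.sum_add_distrib]
  rw [Finset.sum_comm (f := fun j i => 2 * (D i w x * D j (D j (D i w)) x))]
  simp_rw [← Finset.mul_sum, key]
  simp only [gr, mul_sub, Finset.sum_sub_distrib, mul_neg, Finset.sum_neg_distrib, Finset.mul_sum]
  rw [sub_eq_add_neg, sub_eq_add_neg, sub_eq_add_neg, add_assoc]
  congr 2
  congr 1
  refine Finset.sum_congr rfl fun i _ => ?_
  ring

lemma trace_le (H : Fin n → Fin n → ℝ) : (∑ i, H i i) ^ 2 ≤ n * ∑ j, ∑ i, H j i ^ 2 := by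
  have h1 : (∑ i, H i i) ^ 2 ≤ n * ∑ i, H i i ^ 2 := by
    simpa using sq_sum_le_card_mul_sum_sq (s := Finset.univ) (f := fun i => H i i)
  refine h1.trans (mul_le_mul_of_nonneg_left ?_ (Nat.cast_nonneg n))
  refine Finset.sum_le_sum fun i _ => ?_
  exact Finset.single_le_sum (f := fun k => H i k ^ 2) (fun k _ => sq_nonneg _) (Finset.mem_univ i)

lemma alg (hn : 1 ≤ n) {p : ℝ} (hp : p < 4 / n) :
    ∃ δ > 0, ∀ f h : ℝ, 0 ≤ f → 0 ≤ h → δ * f ^ 2 ≤ 2 / n * (f + h) ^ 2 - 2 * p * h * f := by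
  have hn' : (0 : ℝ) < n := by exact_mod_cast hn
  have h4 : (4 : ℝ) / n = 2 * (2 / n) := by ring
  have h2 : (0 : ℝ) < 2 / n := by positivity
  set c : ℝ := 2 / n
  rw [h4] at hp
  rcases le_total p 0 with h0 | h0
  · refine ⟨c, h2, fun f h hf hh => ?_⟩
    have : 0 ≤ (-p) * (h * f) := mul_nonneg (by linarith) (by positivity)
    have : 0 ≤ c * (h * f) := by positivity
    have : 0 ≤ c * h ^ 2 := by positivity
    nlinarith
  · refine ⟨c - p / 2, by linarith, fun f h hf hh => ?_⟩
    have a1 : 0 ≤ (c - p / 2) * (2 * (f * h) + h ^ 2) := mul_nonneg (by linarith) (by positivity)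
    have a2 : 0 ≤ p * (f - h) ^ 2 := by positivity
    nlinarith

lemma subsol (hn : 1 ≤ n) {p : ℝ} (hp : p < 4 / n) : ∃ δ > 0,
    ∀ w h : EuclideanSpace ℝ (Fin n) → ℝ, ContDiff ℝ ∞ w → ContDiff ℝ ∞ h → (∀ x, 0 ≤ h x) →
    (∀ i x, D i h x = p * h x * D i w x) →
    (∀ x, ∑ i, D i (D i w) x = -(gr w x + h x)) → ∀ x, 
    δ * gr w x ^ 2 - 2 * ∑ i, D i w x * D i (gr w) x ≤ ∑ j, D j (D j (gr w)) x := by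
  obtain ⟨δ, hδ, H⟩ := alg hn hp
  refine ⟨δ, hδ, fun w h hw hh hpos hD heq x => ?_⟩
  have hn' : (0 : ℝ) < n := by exact_mod_cast hn
  rw [bochner hw hh hD heq]
  have h1 := trace_le (fun j i => D j (D i w) x)
  rw [heq] at h1
  have h2 := H (gr w x) (h x) (Finset.sum_nonneg fun i _ => mul_self_nonneg _) (hpos x)
  have h3 : 2 / n * (gr w x + h x) ^ 2 ≤ 2 * ∑ j, ∑ i, D j (D i w) x ^ 2 := by
    rw [div_mul_eq_mul_div, div_le_iff₀ hn']
    nlinarith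
  linarith

/-- cutoff -/
noncomputable def ct (R : ℝ) : EuclideanSpace ℝ (Fin n) → ℝ := fun x => R ^ 2 + -∑ j, x j * x j

lemma coord_smooth (j : Fin n) : ContDiff ℝ ∞ (fun x : EuclideanSpace ℝ (Fin n) => x j) :=
  (EuclideanSpace.proj (𝕜 := ℝ) j : EuclideanSpace ℝ (Fin n) →L[ℝ] ℝ).contDiff

lemma ct_smooth (R : ℝ) : ContDiff ℝ ∞ (ct R : EuclideanSpace ℝ (Fin n) → ℝ) :=
  contDiff_const.add (ContDiff.sum fun j _ => (coord_smooth j).mul (coord_smooth j)).neg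

lemma D_ct (R : ℝ) (i : Fin n) : D i (ct R) = fun x => (-2) * x i := by
  have s : ∀ j : Fin n, ContDiff ℝ ∞ (fun x : EuclideanSpace ℝ (Fin n) => x j * x j) :=
    fun j => (coord_smooth j).mul (coord_smooth j)
  unfold ct
  rw [D_add i contDiff_const (ContDiff.sum fun j _ => s j).neg, D_neg, D_sum i s, D_const]
  funext x
  simp only [D_mul i (coord_smooth _) (coord_smooth _), D_coord]
  simp [Finset.sum_add_distrib]
  ring

lemma DD_ct (R : ℝ) (i : Fin n) : D i (D i (ct R)) = fun _ => -2 := by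
  rw [D_ct, D_mul i contDiff_const (coord_smooth i), D_const, D_coord]
  simp

lemma max_bound {δ R : ℝ} (hδ : 0 < δ) (hR : 0 < R) {w : EuclideanSpace ℝ (Fin n) → ℝ}
    (hw : ContDiff ℝ ∞ w) {x : EuclideanSpace ℝ (Fin n)}
    (hs : δ * gr w x ^ 2 - 2 * ∑ i, D i w x * D i (gr w) x ≤ ∑ j, D j (D j (gr w)) x)
    (hg : 0 < ct R x)
    (hm : IsLocalMax (fun x => ct R x * ct R x * gr w x) x) :
    ct R x * ct R x * gr w x ≤ ((1 + (32 + 4 * n) / δ) * R) ^ 2 := by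
  have sc := ct_smooth (n := n) R
  have sf := gr_smooth hw
  have sx : ∑ j, x j ^ 2 = R ^ 2 - ct R x := by unfold ct; simp only [pow_two]; ring
  have f0 : 0 ≤ gr w x := Finset.sum_nonneg fun i _ => mul_self_nonneg _
  rcases f0.eq_or_lt with f0 | f0
  · rw [← f0]; simp; positivity
  set g := ct R x with hgdef
  set f := gr w x with hfdef
  have DG : ∀ i, D i (fun x => ct R x * ct R x * gr w x) =
      fun x => (D i (ct R) x * ct R x + ct R x * D i (ct R) x) * gr w x
        + ct R x * ct R x * D i (gr w) x := by
    intro i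
    rw [D_mul i (sc.mul sc) sf, D_mul i sc sc]
  have e1 : ∀ i, g * D i (gr w) x = 4 * x i * f := by
    intro i
    have h := D_max i hm
    rw [DG i] at h
    simp only [D_ct] at h
    have : g * (g * D i (gr w) x - 4 * x i * f) = 0 := by
      rw [← h]; ring
    rcases mul_eq_zero.1 this with h | h
    · linarith
    · linarith
  have e2 : ∀ i, g ^ 2 * D i (D i (gr w)) x ≤ 24 * x i ^ 2 * f + 4 * g * f := by
    intro i
    have h := DD_max i ((sc.mul sc).mul sf) hm
    have s1 := D_smooth i sc
    have s2 := D_smooth i sf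
    rw [DG i, D_add i (((s1.mul sc).add (sc.mul s1)).mul sf) ((sc.mul sc).mul s2),
      D_mul i ((s1.mul sc).add (sc.mul s1)) sf, D_mul i (sc.mul sc) s2,
      D_add i (s1.mul sc) (sc.mul s1), D_mul i s1 sc, D_mul i sc s1, D_mul i sc sc, DD_ct] at h
    simp only [D_ct] at h
    rw [← hgdef, ← hfdef] at h
    have := e1 i
    have e3 : g * D i (gr w) x * x i = 4 * x i * f * x i := by rw [this]
    nlinarith
  have e3 : g ^ 2 * ∑ j, D j (D j (gr w)) x ≤ 24 * (R ^ 2 - g) * f + n * (4 * g * f) := by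
    rw [Finset.mul_sum]
    refine (Finset.sum_le_sum fun i _ => e2 i).trans (le_of_eq ?_)
    rw [Finset.sum_add_distrib, ← Finset.sum_mul, ← Finset.mul_sum, sx]
    simp
  have gR : g ≤ R ^ 2 := by
    have : 0 ≤ ∑ j, x j ^ 2 := Finset.sum_nonneg fun i _ => sq_nonneg _
    linarith
  have e4 : g * ∑ i, D i w x * D i (gr w) x = 4 * f * ∑ i, D i w x * x i := by
    rw [Finset.mul_sum, Finset.mul_sum]
    refine Finset.sum_congr rfl fun i _ => ?_
    linear_combination (D i w x) * e1 i
  set s := √f with hsdef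
  have hs0 : 0 < s := Real.sqrt_pos.2 f0
  have hss : f = s ^ 2 := (Real.sq_sqrt f0.le).symm
  have cs : ∑ i, D i w x * x i ≤ s * R := by
    apply le_of_sq_le_sq _ (by positivity)
    have := Finset.sum_mul_sq_le_sq_mul_sq Finset.univ (fun i => D i w x) (fun i => x i)
    have hf2 : ∑ i, D i w x ^ 2 = s ^ 2 := by
      rw [← hss, hfdef]; simp only [gr, pow_two]
    rw [hf2, sx] at this
    nlinarith [sq_nonneg s]
  have e5 : g ^ 2 * (δ * f ^ 2) - 8 * g * f * (s * R) ≤ (24 + 4 * n) * R ^ 2 * f := by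
    have t1 := mul_le_mul_of_nonneg_left hs (sq_nonneg g)
    have t2 : g * f * ∑ i, D i w x * x i ≤ g * f * (s * R) :=
      mul_le_mul_of_nonneg_left cs (by positivity)
    have t3 : g ^ 2 * ∑ i, D i w x * D i (gr w) x = 4 * (g * f * ∑ i, D i w x * x i) := by
      linear_combination g * e4
    have t4 : 0 ≤ (n : ℝ) * f * (R ^ 2 - g) := mul_nonneg (by positivity) (by linarith)
    have t5 : 0 ≤ g * f := by positivity
    nlinarith
  have e6 : δ * (g * s) ^ 2 ≤ 8 * R * (g * s) + (24 + 4 * n) * R ^ 2 := by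
    have : f * (δ * (g * s) ^ 2) ≤ f * (8 * R * (g * s) + (24 + 4 * n) * R ^ 2) := by
      have : g ^ 2 * (δ * f ^ 2) = f * (δ * (g * s) ^ 2) := by
        linear_combination g ^ 2 * δ * f * hss
      linarith
    exact le_of_mul_le_mul_left this f0
  have e7 : g * g * f = (g * s) ^ 2 := by rw [hss]; ring
  rw [e7]
  set y := g * s
  have hy : 0 < y := mul_pos hg hs0
  refine pow_le_pow_left₀ hy.le ?_ 2
  by_contra! hlt
  have q1 : 0 ≤ (32 + 4 * (n : ℝ)) / δ := by positivity
  have q2 : R ≤ y := by nlinarith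
  have q3 : δ * y ≤ (32 + 4 * n) * R := by
    have : (24 + 4 * (n : ℝ)) * R ^ 2 ≤ (24 + 4 * n) * R * y := by
      rw [pow_two, ← mul_assoc]
      exact mul_le_mul_of_nonneg_left q2 (by positivity)
    have : y * (δ * y) ≤ y * ((32 + 4 * n) * R) := by nlinarith
    exact le_of_mul_le_mul_left this hy
  have q4 : y ≤ (32 + 4 * n) / δ * R := by
    rw [div_mul_eq_mul_div, le_div_iff₀ hδ]; linarith
  linarith

lemma bound {δ R : ℝ} (hδ : 0 < δ) (hR : 0 < R) {w : EuclideanSpace ℝ (Fin n) → ℝ}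
    (hw : ContDiff ℝ ∞ w) 
    (hs : ∀ x, δ * gr w x ^ 2 - 2 * ∑ i, D i w x * D i (gr w) x ≤ ∑ j, D j (D j (gr w)) x)
    (z : EuclideanSpace ℝ (Fin n)) (hz : ‖z‖ < R) :
    ct R z * ct R z * gr w z ≤ ((1 + (32 + 4 * n) / δ) * R) ^ 2 := by
  have ctn : ∀ x : EuclideanSpace ℝ (Fin n), ct R x = R ^ 2 - ‖x‖ ^ 2 := by
    intro x
    rw [EuclideanSpace.norm_sq_eq]
    simp [ct, pow_two]; ring
  have hc : Continuous (fun x => ct R x * ct R x * gr w x) :=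
    (((ct_smooth R).mul (ct_smooth R)).mul (gr_smooth hw)).continuous
  obtain ⟨x, hx, hmax⟩ := (isCompact_closedBall (0 : EuclideanSpace ℝ (Fin n)) R).exists_isMaxOn
    ⟨0, by simp [hR.le]⟩ hc.continuousOn
  refine (hmax (show z ∈ Metric.closedBall 0 R by simpa using hz.le)).trans ?_
  have hx' : ‖x‖ ≤ R := by simpa using hx
  rcases hx'.eq_or_lt with h | h
  · have : ct R x = 0 := by rw [ctn, h]; ring
    simp only [this]; simp; positivity
  · refine max_bound hδ hR hw (hs x) ?_ ?_
    · rw [ctn]; nlinarith [norm_nonneg x]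
    · exact hmax.isLocalMax (Metric.closedBall_mem_nhds_of_mem (by simpa using h))

lemma gr_zero {δ : ℝ} (hδ : 0 < δ) {w : EuclideanSpace ℝ (Fin n) → ℝ}
    (hw : ContDiff ℝ ∞ w) 
    (hs : ∀ x, δ * gr w x ^ 2 - 2 * ∑ i, D i w x * D i (gr w) x ≤ ∑ j, D j (D j (gr w)) x)
    (z : EuclideanSpace ℝ (Fin n)) : gr w z = 0 := by
  have ctn : ∀ R, ∀ x : EuclideanSpace ℝ (Fin n), ct R x = R ^ 2 - ‖x‖ ^ 2 := by
    intro R x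
    rw [EuclideanSpace.norm_sq_eq]
    simp [ct, pow_two]; ring
  have f0 : 0 ≤ gr w z := Finset.sum_nonneg fun i _ => mul_self_nonneg _
  by_contra hne
  have f0 : 0 < gr w z := lt_of_le_of_ne f0 (Ne.symm hne)
  set C := (1 + (32 + 4 * (n : ℝ)) / δ) with hC
  set f := gr w z
  set R := 2 * ‖z‖ + 1 + 2 * C ^ 2 / f with hRdef
  have hCf : 0 ≤ C ^ 2 / f := by positivity
  have hCf' : C ^ 2 = C ^ 2 / f * f := by field_simp
  have hz := norm_nonneg z
  have e0 : 2 * C ^ 2 / f = 2 * (C ^ 2 / f) := by ring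
  rw [e0] at hRdef
  have hR : 0 < R := by linarith
  have hb := bound hδ hR hw hs z (by linarith)
  rw [ctn, ← hC] at hb
  set k := C ^ 2 / f
  have hR1 : 1 ≤ R := by linarith
  have h1 : R ^ 2 / 2 ≤ R ^ 2 - ‖z‖ ^ 2 := by nlinarith
  have h2 : (R ^ 2 / 2) * (R ^ 2 / 2) ≤ (R ^ 2 - ‖z‖ ^ 2) * (R ^ 2 - ‖z‖ ^ 2) :=
    mul_le_mul h1 h1 (by positivity) (by nlinarith)
  have h3 := mul_le_mul_of_nonneg_right h2 f0.le
  have h4 : (R ^ 2 * f) * (R ^ 2) ≤ (R ^ 2 * f) * (4 * k) := by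
    rw [mul_pow] at hb
    rw [hCf'] at hb
    linarith
  have h5 : R ^ 2 ≤ 4 * k := le_of_mul_le_mul_left h4 (by positivity)
  nlinarith

end Liou

open Liou

theorem stmt14 (n : ℕ) (hn : 1 ≤ n) (a p : ℝ) (ha : 0 < a) (hp : p < 4 / n) :
    ¬∃ u : EuclideanSpace ℝ (Fin n) → ℝ,
      ContDiff ℝ (⊤ : ℕ∞) u ∧ (∀ x, 0 < u x) ∧
        ∀ x, lap n u x + a * u x ^ (p + 1) = 0 := by
  rintro ⟨u, hu, hpos, heq⟩
  obtain ⟨δ, hδ, H⟩ := subsol hn hp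
  set w : EuclideanSpace ℝ (Fin n) → ℝ := fun x => Real.log (u x) with hwdef
  set h : EuclideanSpace ℝ (Fin n) → ℝ := fun x => a * Real.exp (p * w x) with hhdef
  have hw : ContDiff ℝ ∞ w := hu.log (fun x => (hpos x).ne')
  have hh : ContDiff ℝ ∞ h := contDiff_const.mul (contDiff_const.mul hw).exp
  have hh0 : ∀ x, 0 < h x := fun x => mul_pos ha (Real.exp_pos _)
  have hD : ∀ i x, D i h x = p * h x * D i w x := by
    intro i x
    have := ((((diffAt hw x).hasFDerivAt).const_mul p).exp).const_mul a
    simp only [D]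
    rw [this.fderiv]
    simp [hhdef]
    ring
  have hDu : ∀ i, D i u = fun x => u x * D i w x := by
    intro i
    funext x
    have := ((diffAt hu x).hasFDerivAt).log (hpos x).ne'
    simp only [D]
    rw [this.fderiv]
    have := (hpos x).ne'
    simp
    field_simp
  have hlap : ∀ x, ∑ i, D i (D i w) x = -(gr w x + h x) := by
    intro x
    have e := heq x
    rw [lap_eq hu] at e
    have e1 : ∀ i, D i (D i u) x = u x * (D i w x * D i w x) + u x * D i (D i w) x := by
      intro i
      rw [hDu i, D_mul i hu (D_smooth i hw), hDu i]
      ring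
    have e2 : a * u x ^ (p + 1) = u x * h x := by
      rw [Real.rpow_add (hpos x), Real.rpow_one, Real.rpow_def_of_pos (hpos x)]
      simp only [hhdef, hwdef]
      rw [mul_comm p]
      ring
    simp_rw [e1, Finset.sum_add_distrib, ← Finset.mul_sum] at e
    rw [e2] at e
    have e3 : u x * (gr w x + ∑ i, D i (D i w) x + h x) = 0 := by
      rw [← e]; simp only [gr]; ring
    have := (mul_eq_zero.1 e3).resolve_left (hpos x).ne'
    linarith
  have hz := gr_zero hδ hw (H w h hw hh (fun x => (hh0 x).le) hD hlap)
  have hDz : ∀ i, D i w = fun _ => 0 := by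
    intro i
    funext x
    have := (Finset.sum_eq_zero_iff_of_nonneg (fun i _ => mul_self_nonneg (D i w x))).1 (hz x) i
      (Finset.mem_univ i)
    exact mul_self_eq_zero.1 this
  have e := hlap 0
  rw [hz] at e
  simp only [hDz, D_const] at e
  have := hh0 0
  simp at e
  linarith
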